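/- arXiv:math/0409360 — 2 statements merged into one kernel-verified Lean document; each statement's English description precedes it below -/
import Mathlib

section
/- For a tensor triangulated functor F : K → L, the map Spc(F) : Spc(L) → Spc(K), Q ↦ F^{-1}(Q), is well-defined and continuous, and (Spc F)^{-1}(supp_K(a)) = supp_L(F(a)) for all objects a of K; moreover Spc(G ∘ F) = Spc(F) ∘ Spc(G). If F is essentially surjective, then Spc(F) is injective. -/
open CategoryTheory CategoryTheory.Limits CategoryTheory.Pretriangulated
open CategoryTheory.MonoidalCategory
open ZeroObject

universe v u

variable (C : Type u) [Category.{v} C] [Preadditive C] [HasZeroObject C]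
  [HasShift C ℤ] [∀ n : ℤ, (shiftFunctor C n).Additive] [Pretriangulated C]
  [HasBinaryBiproducts C] [MonoidalCategory C] [SymmetricCategory C]

/-- A thick tensor-ideal: a class of objects closed under isomorphism, containing 0,
satisfying two-out-of-three for distinguished triangles, closed under direct summands,
and closed under tensoring (on either side) with arbitrary objects. -/
structure IsThickTensorIdeal (J : Set C) : Prop where
  iso_closed : ∀ {a b : C}, (a ≅ b) → a ∈ J → b ∈ J
  zero_mem : (0 : C) ∈ J
  tri₃ : ∀ T : Triangle C, T ∈ (distTriang C) → T.obj₁ ∈ J → T.obj₂ ∈ J → T.obj₃ ∈ J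
  tri₂ : ∀ T : Triangle C, T ∈ (distTriang C) → T.obj₁ ∈ J → T.obj₃ ∈ J → T.obj₂ ∈ J
  tri₁ : ∀ T : Triangle C, T ∈ (distTriang C) → T.obj₂ ∈ J → T.obj₃ ∈ J → T.obj₁ ∈ J
  thick : ∀ a b : C, (a ⊞ b) ∈ J → a ∈ J ∧ b ∈ J
  ideal_right : ∀ a b : C, a ∈ J → a ⊗ b ∈ J
  ideal_left : ∀ a b : C, a ∈ J → b ⊗ a ∈ J

/-- A prime thick tensor-ideal. -/
structure IsPrimeIdeal (P : Set C) extends IsThickTensorIdeal C P : Prop where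
  proper : P ≠ Set.univ
  prime : ∀ a b : C, a ⊗ b ∈ P → a ∈ P ∨ b ∈ P

/-- The Balmer spectrum: the set of prime thick tensor-ideals. -/
def SpcK : Type _ := {P : Set C // IsPrimeIdeal C P}

/-- The support of an object. -/
def suppK (a : C) : Set (SpcK C) := {P | a ∉ P.1}

/-- The Zariski topology, generated by the basic open sets U(a) = {P | a ∈ P}. -/
instance : TopologicalSpace (SpcK C) :=
  TopologicalSpace.generateFrom {U | ∃ a : C, U = {P : SpcK C | a ∈ P.1}}

/-- A tensor-multiplicative collection of objects. -/
def IsMult (S : Set C) : Prop := 𝟙_ C ∈ S ∧ ∀ a ∈ S, ∀ b ∈ S, a ⊗ b ∈ S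

/-- The smallest thick tensor-ideal containing `E`. -/
def genIdeal (E : Set C) : Set C := ⋂₀ {J : Set C | IsThickTensorIdeal C J ∧ E ⊆ J}

/-- The n-fold tensor power of an object (with `tpow a 1 = a`). -/
def tpow (a : C) : ℕ → C
  | 0 => 𝟙_ C
  | 1 => a
  | n+2 => tpow a (n+1) ⊗ a

variable (D : Type u) [Category.{v} D] [Preadditive D] [HasZeroObject D]
  [HasShift D ℤ] [∀ n : ℤ, (shiftFunctor D n).Additive] [Pretriangulated D]
  [HasBinaryBiproducts D] [MonoidalCategory D] [SymmetricCategory D]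

variable (E : Type u) [Category.{v} E] [Preadditive E] [HasZeroObject E]
  [HasShift E ℤ] [∀ n : ℤ, (shiftFunctor E n).Additive] [Pretriangulated E]
  [HasBinaryBiproducts E] [MonoidalCategory E] [SymmetricCategory E]

/-- Proposition 3.6 and Corollary 3.8: functoriality of the spectrum. For a
tensor triangulated functor F : K → L, the map Q ↦ F⁻¹(Q) is a well-defined
continuous map Spc(L) → Spc(K) with (Spc F)⁻¹(supp_K a) = supp_L (F a); it is
contravariantly functorial, and injective when F is essentially surjective. -/
theorem spc_functorial (F : C ⥤ D) [F.Monoidal]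
    [F.CommShift ℤ] [F.IsTriangulated]
    (G : D ⥤ E) [G.Monoidal]
    [G.CommShift ℤ] [G.IsTriangulated] :
    (∀ Q : SpcK D, IsPrimeIdeal C {a : C | F.obj a ∈ Q.1}) ∧
    ∃ f : SpcK D → SpcK C,
      (∀ (Q : SpcK D) (a : C), a ∈ (f Q).1 ↔ F.obj a ∈ Q.1) ∧
      Continuous f ∧
      (∀ a : C, f ⁻¹' suppK C a = suppK D (F.obj a)) ∧
      (∀ (g : SpcK E → SpcK D) (h : SpcK E → SpcK C),
        (∀ (R : SpcK E) (b : D), b ∈ (g R).1 ↔ G.obj b ∈ R.1) →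
        (∀ (R : SpcK E) (a : C), a ∈ (h R).1 ↔ G.obj (F.obj a) ∈ R.1) →
        h = f ∘ g) ∧
      (F.EssSurj → Function.Injective f) := by
  have hadd : F.Additive := inferInstance
  have key : ∀ Q : SpcK D, IsPrimeIdeal C {a : C | F.obj a ∈ Q.1} := by
    intro Q
    have hQ := Q.2
    exact
      { iso_closed := fun e h => hQ.iso_closed (F.mapIso e) h
        zero_mem := hQ.iso_closed F.mapZeroObject.symm hQ.zero_mem
        tri₃ := fun T hT h₁ h₂ => hQ.tri₃ _ (F.map_distinguished T hT) h₁ h₂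
        tri₂ := fun T hT h₁ h₂ => hQ.tri₂ _ (F.map_distinguished T hT) h₁ h₂
        tri₁ := fun T hT h₁ h₂ => hQ.tri₁ _ (F.map_distinguished T hT) h₁ h₂
        thick := fun a b h => by
          have := preservesBinaryBiproducts_of_preservesBiproducts F
          exact hQ.thick _ _ (hQ.iso_closed (F.mapBiprod a b) h)
        ideal_right := fun a b h =>
          hQ.iso_closed (Functor.Monoidal.μIso F a b) (hQ.ideal_right _ _ h)
        ideal_left := fun a b h =>
          hQ.iso_closed (Functor.Monoidal.μIso F b a) (hQ.ideal_left _ _ h)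
        proper := fun h => by
          have h1 : 𝟙_ C ∈ {a : C | F.obj a ∈ Q.1} := h ▸ Set.mem_univ _
          have h2 : 𝟙_ D ∈ Q.1 := hQ.iso_closed (Functor.Monoidal.εIso F).symm h1
          exact hQ.proper (Set.eq_univ_of_forall fun b =>
            hQ.iso_closed (λ_ b) (hQ.ideal_right _ b h2))
        prime := fun a b h =>
          hQ.prime _ _ (hQ.iso_closed (Functor.Monoidal.μIso F a b).symm h) }
  refine ⟨key, fun Q => ⟨_, key Q⟩, fun Q a => Iff.rfl, ?_, fun a => rfl, ?_, ?_⟩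
  · refine continuous_generateFrom_iff.2 ?_
    rintro _ ⟨a, rfl⟩
    exact TopologicalSpace.isOpen_generateFrom_of_mem ⟨F.obj a, rfl⟩
  · intro g h hg hh
    funext R
    apply Subtype.ext
    ext a
    exact (hh R a).trans (hg R (F.obj a)).symm
  · intro hF Q Q' hQQ
    have hs : {a : C | F.obj a ∈ Q.1} = {a : C | F.obj a ∈ Q'.1} := congrArg Subtype.val hQQ
    have hm : ∀ a : C, F.obj a ∈ Q.1 ↔ F.obj a ∈ Q'.1 := fun a => Set.ext_iff.1 hs a
    apply Subtype.ext
    ext b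
    have e := F.objObjPreimageIso b
    exact ⟨fun hb => Q'.2.iso_closed e ((hm _).1 (Q.2.iso_closed e.symm hb)),
      fun hb => Q.2.iso_closed e ((hm _).2 (Q'.2.iso_closed e.symm hb))⟩
end

section
/- Let q : K → L = K/J be the Verdier quotient by a thick tensor-ideal J. Then Spc(q) : Spc(L) → Spc(K) is a homeomorphism onto the subspace {P ∈ Spc(K) : J ⊆ P} of primes containing J. -/
open CategoryTheory CategoryTheory.Limits CategoryTheory.Pretriangulated
open CategoryTheory.MonoidalCategory
open ZeroObject

universe v u

variable (C : Type u) [Category.{v} C] [Preadditive C] [HasZeroObject C]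
  [HasShift C ℤ] [∀ n : ℤ, (shiftFunctor C n).Additive] [Pretriangulated C]
  [HasBinaryBiproducts C] [MonoidalCategory C] [SymmetricCategory C]

/-- Morphisms whose cone lies in `J`: the class of morphisms inverted in the
Verdier quotient K/J. -/
def coneW (J : Set C) : MorphismProperty C :=
  fun x _ s => ∃ (z : C) (g : _ ⟶ z) (δ : z ⟶ x⟦(1:ℤ)⟧),
    z ∈ J ∧ Triangle.mk s g δ ∈ (distTriang C)

variable (L : Type u) [Category.{v} L] [Preadditive L] [HasZeroObject L]
  [HasShift L ℤ] [∀ n : ℤ, (shiftFunctor L n).Additive] [Pretriangulated L]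
  [HasBinaryBiproducts L] [MonoidalCategory L] [SymmetricCategory L]

section helpers

variable {C}

lemma IsThickTensorIdeal.shift_mem {J : Set C} (hJ : IsThickTensorIdeal C J) {a : C}
    (ha : a ∈ J) : a⟦(1:ℤ)⟧ ∈ J :=
  hJ.tri₃ _ (contractible_distinguished₂ a) ha hJ.zero_mem

lemma IsThickTensorIdeal.shift_neg_mem {J : Set C} (hJ : IsThickTensorIdeal C J) {a : C}
    (ha : a ∈ J) : a⟦(-1:ℤ)⟧ ∈ J :=
  hJ.tri₁ _ (contractible_distinguished₂ (a⟦(-1:ℤ)⟧)) hJ.zero_mem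
    (hJ.iso_closed (shiftNegShift a (1:ℤ)).symm ha)

lemma IsThickTensorIdeal.biprod_mem {J : Set C} (hJ : IsThickTensorIdeal C J) {a b : C}
    (ha : a ∈ J) (hb : b ∈ J) : (a ⊞ b) ∈ J :=
  hJ.tri₂ _ (binaryBiproductTriangle_distinguished a b) ha hb

/-- The multiplicative closure of `coneW`. -/
abbrev coneW' (J : Set C) : MorphismProperty C := (coneW C J).multiplicativeClosure

lemma coneW_ore {J : Set C} {X X' Y : C} (s : X ⟶ X') (hs : coneW C J s) (f : X ⟶ Y) :
    ∃ (Y' : C) (t : Y ⟶ Y') (g : X' ⟶ Y'), coneW C J t ∧ f ≫ t = s ≫ g := by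
  obtain ⟨Z, g, δ, hZ, H⟩ := hs
  obtain ⟨Y', s', f', mem'⟩ := distinguished_cocone_triangle₂ (δ ≫ f⟦1⟧')
  obtain ⟨b, ⟨hb₁, _⟩⟩ :=
    complete_distinguished_triangle_morphism₂ _ _ H mem' f (𝟙 Z) (Category.id_comp _).symm
  exact ⟨Y', s', b, ⟨_, _, _, hZ, mem'⟩, hb₁.symm⟩

lemma coneW'_ore_one {J : Set C} {X X' Y : C} (s : X ⟶ X') (hs : coneW C J s) (f : X ⟶ Y) :
    ∃ (Y' : C) (t : Y ⟶ Y') (g : X' ⟶ Y'), coneW' J t ∧ f ≫ t = s ≫ g := by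
  obtain ⟨Y', t, g, ht, h⟩ := coneW_ore s hs f
  exact ⟨Y', t, g, .of _ ht, h⟩

lemma coneW'_ore {J : Set C} {X X' : C} (s : X ⟶ X') (hs : coneW' J s) :
    ∀ {Y : C} (f : X ⟶ Y),
    ∃ (Y' : C) (t : Y ⟶ Y') (g : X' ⟶ Y'), coneW' J t ∧ f ≫ t = s ≫ g := by
  induction hs with
  | of s hs => exact fun f => coneW'_ore_one s hs f
  | id x => exact fun f => ⟨_, 𝟙 _, f, .id _, by simp⟩
  | comp_of s₁ s₂ h₁ h₂ ih =>
    intro Y f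
    obtain ⟨Y', t, g, ht, h⟩ := ih f
    obtain ⟨Y'', t', g', ht', h'⟩ := coneW'_ore_one s₂ h₂ g
    refine ⟨Y'', t ≫ t', g', (coneW' J).comp_mem _ _ ht ht', ?_⟩
    rw [← Category.assoc, h, Category.assoc, h', Category.assoc]

lemma coneW_ext {J : Set C} (hJ : IsThickTensorIdeal C J) {X' X Y : C} (f : X ⟶ Y)
    (s : X' ⟶ X) (hs : coneW C J s) (h : s ≫ f = 0) :
    ∃ (Y' : C) (t : Y ⟶ Y'), coneW' J t ∧ f ≫ t = 0 := by
  obtain ⟨Z, g, δ, hZ, H⟩ := hs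
  obtain ⟨q, hq⟩ : ∃ q : Z ⟶ Y, f = g ≫ q := Triangle.yoneda_exact₂ _ H f h
  obtain ⟨Y', r, t, mem'⟩ := distinguished_cocone_triangle q
  refine ⟨Y', r, .of _ ⟨_, _, _, hJ.shift_mem hZ, rot_of_distTriang _ mem'⟩, ?_⟩
  have eq : q ≫ r = 0 := comp_distTriang_mor_zero₁₂ _ mem'
  rw [hq, Category.assoc, eq, comp_zero]

lemma coneW'_ext {J : Set C} (hJ : IsThickTensorIdeal C J) {X' X : C}
    (s : X' ⟶ X) (hs : coneW' J s) : ∀ {Y : C} (f : X ⟶ Y) (_ : s ≫ f = 0),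
    ∃ (Y' : C) (t : Y ⟶ Y'), coneW' J t ∧ f ≫ t = 0 := by
  induction hs with
  | of s hs => exact fun f h => coneW_ext hJ f s hs h
  | id x => exact fun f h => ⟨_, 𝟙 _, .id _, by simpa using h⟩
  | comp_of s₁ s₂ h₁ h₂ ih =>
    intro Y f h
    obtain ⟨Y', t, ht, e⟩ := ih (s₂ ≫ f) (by simpa using h)
    obtain ⟨Y'', t', ht', e'⟩ := coneW_ext hJ (f ≫ t) s₂ h₂ (by simpa using e)
    exact ⟨Y'', t ≫ t', (coneW' J).comp_mem _ _ ht ht', by simpa using e'⟩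

lemma coneW'_calculus {J : Set C} (hJ : IsThickTensorIdeal C J) :
    (coneW' J).HasLeftCalculusOfFractions where
  exists_leftFraction X Y φ := by
    obtain ⟨Y', t, g, ht, h⟩ := coneW'_ore φ.s φ.hs φ.f
    exact ⟨.mk g t ht, h⟩
  ext X' X Y f₁ f₂ s hs h := by
    obtain ⟨Y', t, ht, e⟩ := coneW'_ext hJ s hs (f₁ - f₂) (by simp [h])
    exact ⟨Y', t, ht, by simpa [sub_eq_zero] using e⟩

/-- `x` factors through an object of `J`. -/
def FactorsJ (J : Set C) {a b : C} (x : a ⟶ b) : Prop :=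
  ∃ (j : C) (i : a ⟶ j) (p : j ⟶ b), j ∈ J ∧ x = i ≫ p

lemma FactorsJ.of_comp_coneW {J : Set C} (hJ : IsThickTensorIdeal C J) {a z w : C}
    (x : a ⟶ z) (s : z ⟶ w) (hs : coneW C J s) (h : FactorsJ J (x ≫ s)) : FactorsJ J x := by
  obtain ⟨k, g, δ, hk, H⟩ := hs
  obtain ⟨j, i, p, hj, e⟩ := h
  have hsg : s ≫ g = 0 := comp_distTriang_mor_zero₁₂ _ H
  obtain ⟨m, u, v, hm⟩ := distinguished_cocone_triangle₁ (p ≫ g)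
  have hmJ : m ∈ J := hJ.tri₁ _ hm hj hk
  obtain ⟨i', hi'⟩ : ∃ i' : a ⟶ m, i = i' ≫ u := Triangle.coyoneda_exact₂ _ hm i (by
    change i ≫ p ≫ g = 0
    rw [← Category.assoc, ← e, Category.assoc, hsg, comp_zero])
  obtain ⟨r, hr⟩ : ∃ r : m ⟶ z, u ≫ p = r ≫ s := by
    obtain ⟨r, hr, _⟩ := complete_distinguished_triangle_morphism₁ _ _ hm H p (𝟙 k)
      (Category.comp_id _)
    exact ⟨r, hr⟩
  have h0 : (x - i' ≫ r) ≫ s = 0 := by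
    rw [Preadditive.sub_comp, e, hi', Category.assoc, Category.assoc, hr, sub_self]
  obtain ⟨y, d, hy⟩ : ∃ (y : a ⟶ k⟦(-1:ℤ)⟧) (d : k⟦(-1:ℤ)⟧ ⟶ z), x - i' ≫ r = y ≫ d := by
    obtain ⟨y, hy⟩ := Triangle.coyoneda_exact₂ _ (inv_rot_of_distTriang _ H) (x - i' ≫ r) h0
    exact ⟨y, _, hy⟩
  refine ⟨m ⊞ (k⟦(-1:ℤ)⟧), biprod.lift i' y, biprod.desc r d,
    hJ.biprod_mem hmJ (hJ.shift_neg_mem hk), ?_⟩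
  rw [biprod.lift_desc, ← hy]
  abel

lemma FactorsJ.of_comp_coneW' {J : Set C} (hJ : IsThickTensorIdeal C J) {z w : C}
    (s : z ⟶ w) (hs : coneW' J s) : ∀ {a : C} (x : a ⟶ z) (_ : FactorsJ J (x ≫ s)),
    FactorsJ J x := by
  induction hs with
  | of s hs => exact fun x h => FactorsJ.of_comp_coneW hJ x s hs h
  | id z => exact fun x h => by simpa using h
  | comp_of s₁ s₂ h₁ h₂ ih =>
    intro a x h
    exact ih x (FactorsJ.of_comp_coneW hJ _ s₂ h₂ (by simpa using h))

lemma IsThickTensorIdeal.mem_of_factors {J : Set C} (hJ : IsThickTensorIdeal C J) {z : C}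
    (h : FactorsJ J (𝟙 z)) : z ∈ J := by
  obtain ⟨j, i, p, hj, e⟩ := h
  obtain ⟨c, g, δ, H⟩ := distinguished_cocone_triangle i
  have hm : Mono i := by
    have : Mono (i ≫ p) := by rw [← e]; infer_instance
    exact mono_of_mono i p
  obtain ⟨e', _⟩ := exists_iso_binaryBiproduct_of_distTriang _ H
    (Triangle.mor₃_eq_zero_of_mono₁ _ H hm)
  exact (hJ.thick _ _ (hJ.iso_closed e' hj)).1

section

variable {L}
variable {J : Set C}

lemma coneW'_localization (q : C ⥤ L) [q.IsLocalization (coneW C J)] : q.IsLocalization (coneW' J) := by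
  refine Functor.IsLocalization.of_equivalence_source q (coneW C J) q (coneW' J)
    CategoryTheory.Equivalence.refl ?_ ?_ (Functor.leftUnitor q)
  · intro X Y f hf
    exact MorphismProperty.le_isoClosure _ _ (MorphismProperty.multiplicativeClosure.of f hf)
  · intro X Y f hf
    induction hf with
    | of f hf => exact Localization.inverts q (coneW C J) f hf
    | id x => infer_instance
    | comp_of f g hf hg ih =>
      have := Localization.inverts q (coneW C J) g hg
      rw [q.map_comp]
      infer_instance

lemma isZero_obj_of_mem (hJ : IsThickTensorIdeal C J) (q : C ⥤ L) [q.CommShift ℤ]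
    [q.IsTriangulated] [q.IsLocalization (coneW C J)] {a : C} (ha : a ∈ J) : IsZero (q.obj a) := by
  have h : coneW C J (0 : (0 : C) ⟶ a) := ⟨_, _, _, ha, contractible_distinguished₁ a⟩
  have := Localization.inverts q (coneW C J) _ h
  exact (q.map_isZero (isZero_zero C)).of_iso (asIso (q.map (0 : (0 : C) ⟶ a))).symm

lemma mem_of_isZero_obj (hJ : IsThickTensorIdeal C J) (q : C ⥤ L) [q.CommShift ℤ]
    [q.IsTriangulated] [q.IsLocalization (coneW C J)] {z : C} (hz : IsZero (q.obj z)) : z ∈ J := by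
  have := coneW'_calculus hJ
  have := coneW'_localization (J := J) q
  obtain ⟨w, s, hs, e⟩ := (MorphismProperty.map_eq_iff_postcomp q (coneW' J) (𝟙 z) 0).1
    (hz.eq_of_src _ _)
  refine hJ.mem_of_factors (FactorsJ.of_comp_coneW' hJ s hs _ ?_)
  rw [e]
  exact ⟨0, 0, 0, hJ.zero_mem, by simp⟩

lemma cone_transfer (hJ : IsThickTensorIdeal C J) (q : C ⥤ L) [q.CommShift ℤ]
    [q.IsTriangulated] [q.IsLocalization (coneW C J)] {P : Set C} (hP : IsThickTensorIdeal C P) (hJP : J ⊆ P) {a b : C}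
    (f : a ⟶ b) [IsIso (q.map f)] : a ∈ P ↔ b ∈ P := by
  obtain ⟨c, g, δ, H⟩ := distinguished_cocone_triangle f
  have hc : c ∈ P := hJP (mem_of_isZero_obj hJ q
    (Triangle.isZero₃_of_isIso₁ _ (q.map_distinguished _ H) (inferInstanceAs (IsIso (q.map f)))))
  exact ⟨fun h => hP.tri₂ _ H h hc, fun h => hP.tri₁ _ H h hc⟩

lemma iso_transfer (hJ : IsThickTensorIdeal C J) (q : C ⥤ L) [q.CommShift ℤ]
    [q.IsTriangulated] [q.IsLocalization (coneW C J)] {P : Set C} (hP : IsThickTensorIdeal C P) (hJP : J ⊆ P) {a b : C}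
    (e : q.obj a ≅ q.obj b) : a ∈ P ↔ b ∈ P := by
  have := coneW'_calculus hJ
  have := coneW'_localization (J := J) q
  obtain ⟨φ, hφ⟩ := Localization.exists_leftFraction q (coneW' J) e.hom
  have hs : IsIso (q.map φ.s) := Localization.inverts q (coneW' J) _ φ.hs
  have hf : IsIso (q.map φ.f) := by
    rw [← φ.map_comp_map_s q (Localization.inverts q (coneW' J)), ← hφ]
    infer_instance
  rw [cone_transfer hJ q hP hJP φ.f, cone_transfer hJ q hP hJP φ.s]

lemma exists_obj_iso (q : C ⥤ L) (J : Set C) [q.IsLocalization (coneW C J)] (x : L) :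
    ∃ a : C, Nonempty (q.obj a ≅ x) := by
  have := Localization.essSurj q (coneW C J)
  exact ⟨_, ⟨q.objObjPreimageIso x⟩⟩

lemma exists_tri (hJ : IsThickTensorIdeal C J) (q : C ⥤ L) [q.CommShift ℤ]
    [q.IsTriangulated] [q.IsLocalization (coneW C J)] (T : Triangle L) (hT : T ∈ (distTriang L)) :
    ∃ (T' : Triangle C), T' ∈ (distTriang C) ∧ Nonempty (q.obj T'.obj₁ ≅ T.obj₁) ∧
      Nonempty (q.obj T'.obj₂ ≅ T.obj₂) ∧ Nonempty (q.obj T'.obj₃ ≅ T.obj₃) := by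
  have := coneW'_calculus hJ
  have := coneW'_localization (J := J) q
  have := Localization.essSurj_mapArrow q (coneW' J)
  obtain ⟨T', hT', ⟨e⟩⟩ := q.mem_mapTriangle_essImage_of_distinguished T hT
  exact ⟨T', hT', ⟨Triangle.π₁.mapIso e⟩, ⟨Triangle.π₂.mapIso e⟩, ⟨Triangle.π₃.mapIso e⟩⟩

/-- The image of `P` in the quotient. -/
def imgSet (q : C ⥤ L) (P : Set C) : Set L := {x | ∃ a ∈ P, Nonempty (q.obj a ≅ x)}

lemma mem_imgSet (hJ : IsThickTensorIdeal C J) (q : C ⥤ L) [q.CommShift ℤ]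
    [q.IsTriangulated] [q.IsLocalization (coneW C J)] {P : Set C} (hP : IsThickTensorIdeal C P) (hJP : J ⊆ P) {a : C} {x : L}
    (e : q.obj a ≅ x) : x ∈ imgSet q P ↔ a ∈ P := by
  constructor
  · rintro ⟨b, hb, ⟨e'⟩⟩
    exact (iso_transfer hJ q hP hJP (e' ≪≫ e.symm)).1 hb
  · exact fun h => ⟨a, h, ⟨e⟩⟩

lemma imgSet_prime (hJ : IsThickTensorIdeal C J) (q : C ⥤ L) [q.CommShift ℤ]
    [q.IsTriangulated] [q.IsLocalization (coneW C J)] [q.Monoidal] {P : Set C} (hP : IsPrimeIdeal C P) (hJP : J ⊆ P) :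
    IsPrimeIdeal L (imgSet q P) := by
  have hm : ∀ {a : C} {x : L} (_ : q.obj a ≅ x), x ∈ imgSet q P ↔ a ∈ P :=
    fun e => mem_imgSet hJ q hP.toIsThickTensorIdeal hJP e
  refine { iso_closed := ?_, zero_mem := ?_, tri₁ := ?_, tri₂ := ?_, tri₃ := ?_, thick := ?_,
           ideal_right := ?_, ideal_left := ?_, proper := ?_, prime := ?_ }
  · rintro x y e ⟨a, ha, ⟨e'⟩⟩
    exact ⟨a, ha, ⟨e' ≪≫ e⟩⟩
  · exact ⟨0, hP.zero_mem, ⟨(q.map_isZero (isZero_zero C)).iso (isZero_zero L)⟩⟩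
  · intro T hT
    obtain ⟨T', hT', ⟨e₁⟩, ⟨e₂⟩, ⟨e₃⟩⟩ := exists_tri hJ q T hT
    rw [hm e₁, hm e₂, hm e₃]
    exact hP.tri₃ T' hT'
  · intro T hT
    obtain ⟨T', hT', ⟨e₁⟩, ⟨e₂⟩, ⟨e₃⟩⟩ := exists_tri hJ q T hT
    rw [hm e₁, hm e₂, hm e₃]
    exact hP.tri₂ T' hT'
  · intro T hT
    obtain ⟨T', hT', ⟨e₁⟩, ⟨e₂⟩, ⟨e₃⟩⟩ := exists_tri hJ q T hT
    rw [hm e₁, hm e₂, hm e₃]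
    exact hP.tri₁ T' hT'
  · intro x y
    obtain ⟨a, ⟨ea⟩⟩ := exists_obj_iso q J x
    obtain ⟨b, ⟨eb⟩⟩ := exists_obj_iso q J y
    have : PreservesBinaryBiproducts q := preservesBinaryBiproducts_of_preservesBinaryProducts q
    rw [hm ea, hm eb, hm (q.mapBiprod a b ≪≫ biprod.mapIso ea eb)]
    exact hP.thick a b
  · intro x y
    obtain ⟨a, ⟨ea⟩⟩ := exists_obj_iso q J x
    obtain ⟨b, ⟨eb⟩⟩ := exists_obj_iso q J y
    rw [hm ea, hm ((Functor.Monoidal.μIso q a b).symm ≪≫ (ea ⊗ᵢ eb))]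
    exact hP.ideal_right a b
  · intro x y
    obtain ⟨a, ⟨ea⟩⟩ := exists_obj_iso q J x
    obtain ⟨b, ⟨eb⟩⟩ := exists_obj_iso q J y
    rw [hm ea, hm ((Functor.Monoidal.μIso q b a).symm ≪≫ (eb ⊗ᵢ ea))]
    exact hP.ideal_left a b
  · intro h
    apply hP.proper
    ext a
    simp only [Set.mem_univ, iff_true]
    exact (hm (Iso.refl (q.obj a))).1 (h ▸ Set.mem_univ _)
  · intro x y
    obtain ⟨a, ⟨ea⟩⟩ := exists_obj_iso q J x
    obtain ⟨b, ⟨eb⟩⟩ := exists_obj_iso q J y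
    rw [hm ea, hm eb, hm ((Functor.Monoidal.μIso q a b).symm ≪≫ (ea ⊗ᵢ eb))]
    exact hP.prime a b

lemma preimage_prime (q : C ⥤ L) [q.CommShift ℤ] [q.IsTriangulated]
    (J : Set C) [q.IsLocalization (coneW C J)] [q.Monoidal] {Q : Set L}
    (hQ : IsPrimeIdeal L Q) : IsPrimeIdeal C {a | q.obj a ∈ Q} := by
  have hi : ∀ {x y : L}, (x ≅ y) → (x ∈ Q ↔ y ∈ Q) :=
    fun e => ⟨hQ.iso_closed e, hQ.iso_closed e.symm⟩
  refine { iso_closed := ?_, zero_mem := ?_, tri₁ := ?_, tri₂ := ?_, tri₃ := ?_, thick := ?_,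
           ideal_right := ?_, ideal_left := ?_, proper := ?_, prime := ?_ }
  · exact fun e h => hQ.iso_closed (q.mapIso e) h
  · exact hQ.iso_closed ((isZero_zero L).iso (q.map_isZero (isZero_zero C))) hQ.zero_mem
  · exact fun T hT => hQ.tri₃ _ (q.map_distinguished T hT)
  · exact fun T hT => hQ.tri₂ _ (q.map_distinguished T hT)
  · exact fun T hT => hQ.tri₁ _ (q.map_distinguished T hT)
  · intro a b h
    have : PreservesBinaryBiproducts q := preservesBinaryBiproducts_of_preservesBinaryProducts q
    exact hQ.thick _ _ (hQ.iso_closed (q.mapBiprod a b) h)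
  · exact fun a b h => hQ.iso_closed (Functor.Monoidal.μIso q a b) (hQ.ideal_right _ _ h)
  · exact fun a b h => hQ.iso_closed (Functor.Monoidal.μIso q b a) (hQ.ideal_left _ _ h)
  · intro h
    apply hQ.proper
    ext x
    obtain ⟨a, ⟨ea⟩⟩ := exists_obj_iso q J x
    have : a ∈ {a | q.obj a ∈ Q} := h ▸ Set.mem_univ _
    simpa using hQ.iso_closed ea this
  · exact fun a b h => hQ.prime _ _ (hQ.iso_closed (Functor.Monoidal.μIso q a b).symm h)

end

end helpers

/-- Proposition 3.11: for the Verdier quotient q : K → L = K/J by a thick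
tensor-ideal J, the map Spc(q) : Q ↦ q⁻¹(Q) is a homeomorphism of Spc(L) onto
the subspace of Spc(K) of primes containing J. -/
theorem spc_of_quotient (J : Set C) (hJ : IsThickTensorIdeal C J)
    (q : C ⥤ L) [q.Monoidal] [q.CommShift ℤ] [q.IsTriangulated]
    [q.IsLocalization (coneW C J)] :
    ∃ h : SpcK L ≃ₜ {P : SpcK C // J ⊆ P.1},
      ∀ (Q : SpcK L) (a : C), a ∈ (h Q).1.1 ↔ q.obj a ∈ Q.1 := by
  have hsub : ∀ Q : SpcK L, J ⊆ {a | q.obj a ∈ Q.1} := fun Q a ha =>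
    Q.2.iso_closed ((isZero_zero L).iso (isZero_obj_of_mem hJ q ha)) Q.2.zero_mem
  let e : SpcK L ≃ {P : SpcK C // J ⊆ P.1} :=
    { toFun := fun Q => ⟨⟨{a | q.obj a ∈ Q.1}, preimage_prime q J Q.2⟩, hsub Q⟩
      invFun := fun P => ⟨imgSet q P.1.1, imgSet_prime hJ q P.1.2 P.2⟩
      left_inv := by
        intro Q
        apply Subtype.ext
        ext x
        constructor
        · rintro ⟨a, ha, ⟨ea⟩⟩
          exact Q.2.iso_closed ea ha
        · intro hx
          obtain ⟨a, ⟨ea⟩⟩ := exists_obj_iso q J x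
          exact ⟨a, Q.2.iso_closed ea.symm hx, ⟨ea⟩⟩
      right_inv := by
        intro P
        apply Subtype.ext
        apply Subtype.ext
        ext a
        exact mem_imgSet hJ q P.1.2.toIsThickTensorIdeal P.2 (Iso.refl (q.obj a)) }
  refine ⟨{ e with
    continuous_toFun := ?_
    continuous_invFun := ?_ }, fun Q a => Iff.rfl⟩
  · refine Continuous.subtype_mk (continuous_generateFrom_iff.2 ?_) _
    rintro _ ⟨a, rfl⟩
    exact TopologicalSpace.isOpen_generateFrom_of_mem ⟨q.obj a, rfl⟩
  · refine continuous_generateFrom_iff.2 ?_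
    rintro _ ⟨x, rfl⟩
    obtain ⟨a, ⟨ea⟩⟩ := exists_obj_iso q J x
    have ho : IsOpen {P : SpcK C | a ∈ P.1} :=
      TopologicalSpace.isOpen_generateFrom_of_mem ⟨a, rfl⟩
    convert ho.preimage (continuous_subtype_val (p := fun P : SpcK C => J ⊆ P.1)) using 1
    ext P
    exact mem_imgSet hJ q P.1.2.toIsThickTensorIdeal P.2 ea
end
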